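/- Let a < b and p1,p2 ∈ (0,1), q_i = 1−p_i, and let μ_{a,b,p1,p2} be the associated measure on [a,b]. Set α = a+(b−a)(p1·q2+p2·q1) and β = (b−a)²·p1·q1·p2·q2. Then for every z ∈ ℂ with Im z > 0, the Stieltjes transform Φ(z) = ∫ 1/(z−x) dμ_{a,b,p1,p2}(x) equals ((1−2p2)z + α − 2q2(a+(b−a)p1) − √((z−α)²−4β)) / (2·p2·(z−a)(b−z)), where √((z−α)²−4β) denotes the unique square root with positive imaginary part. -/

import Mathlib

open MeasureTheory Real Filter Topology Polynomial

noncomputable section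
/-- `l₋` for the measure `μ_{a,b,p1,p2}`. -/
def lmin (a b p1 p2 : ℝ) : ℝ :=
  a + (b - a) * (Real.sqrt (p1 * (1 - p2)) - Real.sqrt (p2 * (1 - p1))) ^ 2

/-- `l₊` for the measure `μ_{a,b,p1,p2}`. -/
def lmax (a b p1 p2 : ℝ) : ℝ :=
  a + (b - a) * (Real.sqrt (p1 * (1 - p2)) + Real.sqrt (p2 * (1 - p1))) ^ 2

/-- Density of the absolutely continuous part of `μ_{a,b,p1,p2}`. -/
def compactDensity (a b p1 p2 : ℝ) (x : ℝ) : ℝ :=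
  if x ∈ Set.Icc (lmin a b p1 p2) (lmax a b p1 p2) then
    Real.sqrt ((x - lmin a b p1 p2) * (lmax a b p1 p2 - x)) /
      (2 * π * p2 * (x - a) * (b - x))
  else 0

/-- The measure `μ_{a,b,p1,p2}` (free binomial / Kesten-McKay measure). -/
def muCompact (a b p1 p2 : ℝ) : Measure ℝ :=
  volume.withDensity (fun x => ENNReal.ofReal (compactDensity a b p1 p2 x))
    + ENNReal.ofReal (max (1 - p1 / p2) 0) • Measure.dirac a
    + ENNReal.ofReal (max ((p1 + p2 - 1) / p2) 0) • Measure.dirac b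

/-- The integral of the Poisson kernel over `[0, π]`, via an explicit primitive. -/
lemma integral_inv_sub_cos {u : ℂ} (hu : ‖u‖ < 1) :
    ∫ θ in (0 : ℝ)..π, (1 - u ^ 2) / (1 - 2 * u * Complex.cos θ + u ^ 2) = (π : ℂ) := by
  have hne : ∀ e : ℂ, ‖e‖ = 1 → 1 - u * e ∈ Complex.slitPlane := by
    intro e he
    left
    have h1 : (u * e).re ≤ ‖u * e‖ := Complex.re_le_norm _
    rw [norm_mul, he, mul_one] at h1
    simp only [Complex.sub_re, Complex.one_re]
    linarith
  have hn1 : ∀ θ : ℝ, ‖Complex.exp (θ * Complex.I)‖ = 1 := Complex.norm_exp_ofReal_mul_I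
  have hn2 : ∀ θ : ℝ, ‖Complex.exp (-(θ * Complex.I))‖ = 1 := fun θ => by
    have := Complex.norm_exp_ofReal_mul_I (-θ)
    simpa using this
  have hfac : ∀ θ : ℝ, 1 - 2 * u * Complex.cos θ + u ^ 2
      = (1 - u * Complex.exp (θ * Complex.I)) * (1 - u * Complex.exp (-(θ * Complex.I))) := by
    intro θ
    have h : Complex.exp (θ * Complex.I) * Complex.exp (-(θ * Complex.I)) = 1 := by
      rw [← Complex.exp_add]; simp
    have hc : Complex.cos θ
        = (Complex.exp (θ * Complex.I) + Complex.exp (-(θ * Complex.I))) / 2 := by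
      rw [Complex.cos]; simp
    rw [hc]
    linear_combination (-u ^ 2) * h
  have hpos : ∀ θ : ℝ, 1 - 2 * u * Complex.cos θ + u ^ 2 ≠ 0 := fun θ => by
    rw [hfac]
    exact mul_ne_zero (Complex.slitPlane_ne_zero (hne _ (hn1 θ)))
      (Complex.slitPlane_ne_zero (hne _ (hn2 θ)))
  have hderiv : ∀ θ ∈ Set.uIcc (0 : ℝ) π, HasDerivAt
      (fun θ : ℝ => (θ : ℂ) + Complex.I * Complex.log (1 - u * Complex.exp (θ * Complex.I))
        - Complex.I * Complex.log (1 - u * Complex.exp (-(θ * Complex.I))))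
      ((1 - u ^ 2) / (1 - 2 * u * Complex.cos θ + u ^ 2)) θ := by
    intro θ _
    have hid : HasDerivAt (fun θ : ℝ => (θ : ℂ)) 1 θ := Complex.ofRealCLM.hasDerivAt
    have hθ : HasDerivAt (fun θ : ℝ => (θ : ℂ) * Complex.I) Complex.I θ := by
      simpa using hid.mul_const Complex.I
    have d1 := (((hθ.cexp.const_mul u).const_sub 1).clog_real (hne _ (hn1 θ))).const_mul Complex.I
    have d2 := (((hθ.neg.cexp.const_mul u).const_sub 1).clog_real
      (hne _ (hn2 θ))).const_mul Complex.I
    refine ((hid.add d1).sub d2).congr_deriv ?_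
    rw [hfac]
    have e1 := Complex.slitPlane_ne_zero (hne _ (hn1 θ))
    have e2 := Complex.slitPlane_ne_zero (hne _ (hn2 θ))
    have h : Complex.exp (θ * Complex.I) * Complex.exp (-(θ * Complex.I)) = 1 := by
      rw [← Complex.exp_add]; simp
    simp only [Pi.neg_apply] at *
    generalize Complex.exp (θ * Complex.I) = e at *
    generalize Complex.exp (-(θ * Complex.I)) = f at *
    field_simp
    simp only [Complex.I_sq]
    linear_combination (-u ^ 2) * h
  rw [intervalIntegral.integral_eq_sub_of_hasDerivAt hderiv]
  · have h1 : Complex.exp (-(π * Complex.I)) = -1 := by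
      rw [Complex.exp_neg, Complex.exp_pi_mul_I]; norm_num
    simp [h1, Complex.exp_pi_mul_I]
  · apply Continuous.intervalIntegrable
    exact continuous_const.div (by fun_prop) hpos

/-- The semicircle integral after the substitution `x = A + R cos θ`. -/
lemma integral_sin_sq_div {d W : ℂ} {R : ℝ} (hR : 0 < R) (hW : W ^ 2 = d ^ 2 - R ^ 2)
    (h : ‖d - W‖ < R ∨ W = 0) :
    IntegrableOn (fun θ : ℝ => ((R * Real.sin θ : ℝ) : ℂ) ^ 2 / (d - (R * Real.cos θ : ℝ)))
      (Set.Ioo 0 π) ∧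
    ∫ θ in Set.Ioo 0 π, ((R * Real.sin θ : ℝ) : ℂ) ^ 2 / (d - (R * Real.cos θ : ℝ))
      = π * (d - W) := by
  have hRc : (R : ℂ) ≠ 0 := by exact_mod_cast hR.ne'
  have hmul : (d - W) * (d + W) = R ^ 2 := by linear_combination -hW
  have hdW : d - W ≠ 0 := by
    intro h0; rw [h0, zero_mul] at hmul; exact pow_ne_zero 2 hRc hmul.symm
  suffices H : ∃ c : ℂ → ℂ, (Continuous fun θ : ℝ => c θ) ∧
      (∀ θ ∈ Set.Ioo 0 π, ((R * Real.sin θ : ℝ) : ℂ) ^ 2 / (d - (R * Real.cos θ : ℝ)) =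
        d + R * Complex.cos θ - W * c θ) ∧ W * ∫ θ in (0 : ℝ)..π, c θ = W * π by
    obtain ⟨c, hc, heq, hi⟩ := H
    have hcont : Continuous fun θ : ℝ => d + R * Complex.cos θ - W * c θ :=
      Continuous.sub (by fun_prop) (continuous_const.mul hc)
    constructor
    · exact (integrableOn_congr_fun heq measurableSet_Ioo).mpr
        ((hcont.integrableOn_Icc).mono_set Set.Ioo_subset_Icc_self)
    · rw [setIntegral_congr_fun measurableSet_Ioo heq, ← integral_Ioc_eq_integral_Ioo,
        ← intervalIntegral.integral_of_le Real.pi_pos.le, intervalIntegral.integral_sub,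
        intervalIntegral.integral_add, intervalIntegral.integral_const_mul,
        intervalIntegral.integral_const_mul, hi]
      · have : ∫ θ in (0 : ℝ)..π, Complex.cos θ = 0 := by
          simp_rw [← Complex.ofReal_cos]
          rw [intervalIntegral.integral_ofReal]; simp
        rw [this]; simp; ring
      all_goals
        apply Continuous.intervalIntegrable
        first
          | fun_prop
          | exact continuous_const.mul hc
  rcases h with h | h
  · set u : ℂ := (d - W) / R with hu
    have hun : ‖u‖ < 1 := by
      rw [hu, norm_div, Complex.norm_real, Real.norm_of_nonneg hR.le]
      exact (div_lt_one hR).mpr h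
    have hdd : d - W = R * u := by rw [hu]; field_simp
    have hu0 : u ≠ 0 := div_ne_zero hdW hRc
    have hds : d + W = R / u := by
      field_simp
      apply mul_left_cancel₀ hRc
      linear_combination hmul - (d + W) * hdd
    have hd : d = R * (1 + u ^ 2) / (2 * u) := by
      field_simp
      have h2 : (d + W) * u = R := by rw [hds]; field_simp
      linear_combination u * hdd + h2
    have hw : W = R * (1 - u ^ 2) / (2 * u) := by
      field_simp
      have h2 : (d + W) * u = R := by rw [hds]; field_simp
      linear_combination -u * hdd + h2
    have hD : ∀ θ : ℝ, 1 - 2 * u * Complex.cos θ + u ^ 2 ≠ 0 := by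
      intro θ h0
      have hb : ∀ e : ℂ, ‖e‖ = 1 → 1 - u * e ≠ 0 := by
        intro e he h1
        have : ‖u * e‖ = 1 := by rw [← sub_eq_zero.mp h1, norm_one]
        rw [norm_mul, he, mul_one] at this
        linarith
      have h1 := hb _ (Complex.norm_exp_ofReal_mul_I θ)
      have h2 := hb _ (Complex.norm_exp_ofReal_mul_I (-θ))
      refine mul_ne_zero h1 h2 ?_
      rw [← h0, Complex.exp_mul_I, Complex.exp_mul_I]
      simp only [Complex.ofReal_neg, Complex.cos_neg, Complex.sin_neg]
      have := Complex.sin_sq_add_cos_sq (θ : ℂ)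
      linear_combination u ^ 2 * this - u ^ 2 * Complex.sin θ ^ 2 * Complex.I_sq
    refine ⟨fun t => (1 - u ^ 2) / (1 - 2 * u * Complex.cos t + u ^ 2),
      continuous_const.div (by fun_prop) hD, ?_, by rw [integral_inv_sub_cos hun]⟩
    intro θ _
    have hne := hD θ
    have hden : d - (R * Real.cos θ : ℝ) = R * (1 - 2 * u * Complex.cos θ + u ^ 2) / (2 * u) := by
      rw [hd]; push_cast; field_simp; ring
    rw [hden]
    rw [hw, hd]
    push_cast
    have hs := Complex.sin_sq_add_cos_sq (θ : ℂ)
    rw [mul_pow, show Complex.sin θ ^ 2 = 1 - Complex.cos θ ^ 2 by linear_combination hs]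
    obtain ⟨D, hDdef⟩ : ∃ D, D = 1 - 2 * u * Complex.cos θ + u ^ 2 := ⟨_, rfl⟩
    have hcos : Complex.cos θ = (1 + u ^ 2 - D) / (2 * u) := by
      rw [hDdef]; field_simp; ring
    rw [← hDdef] at hne ⊢
    rw [hcos]
    field_simp
    ring
  · refine ⟨fun _ => 0, continuous_const, ?_, by simp [h]⟩
    intro θ hθ
    have hs : 0 < Real.sin θ := Real.sin_pos_of_mem_Ioo hθ
    have hsq := Real.sin_sq_add_cos_sq θ
    have hden : d - (R * Real.cos θ : ℝ) ≠ 0 := by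
      intro h0
      have h1 : (d + (R * Real.cos θ : ℝ)) * (d - (R * Real.cos θ : ℝ))
          = ((R ^ 2 * Real.sin θ ^ 2 : ℝ) : ℂ) := by
        rw [show Real.sin θ ^ 2 = 1 - Real.cos θ ^ 2 by linarith]
        push_cast
        rw [h] at hW
        linear_combination -hW
      rw [h0, mul_zero] at h1
      have : R ^ 2 * Real.sin θ ^ 2 = 0 := by exact_mod_cast h1.symm
      have : 0 < R ^ 2 * Real.sin θ ^ 2 := by positivity
      linarith
    rw [div_eq_iff hden]
    have hc := Complex.sin_sq_add_cos_sq (θ : ℂ)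
    rw [h] at hW ⊢
    push_cast
    linear_combination (R : ℂ) ^ 2 * hc + hW

lemma norm_sub_lt_or_eq_zero {d W R : ℝ} (hR : 0 < R) (hW : W ^ 2 = d ^ 2 - R ^ 2)
    (hdW : 0 ≤ d * W) : ‖(d : ℂ) - W‖ < R ∨ (W : ℂ) = 0 := by
  rcases eq_or_ne W 0 with h | h
  · right; exact_mod_cast h
  · left
    rw [← Complex.ofReal_sub, Complex.norm_real, Real.norm_eq_abs]
    apply abs_lt_of_sq_lt_sq _ hR.le
    have hW0 : 0 < W ^ 2 := by positivity
    have : W ^ 2 < d * W := by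
      apply lt_of_pow_lt_pow_left₀ 2 hdW
      nlinarith [mul_pos hW0 (pow_pos hR 2)]
    nlinarith

lemma norm_sub_lt_of_im_pos {d W : ℂ} {R : ℝ} (hR : 0 < R) (hW : W ^ 2 = d ^ 2 - R ^ 2)
    (hd : 0 < d.im) (hw : 0 < W.im) : ‖d - W‖ < R := by
  have hmul : (d - W) * (d + W) = ((R ^ 2 : ℝ) : ℂ) := by push_cast; linear_combination -hW
  have hre := congrArg Complex.re hmul
  have him := congrArg Complex.im hmul
  simp only [Complex.mul_re, Complex.mul_im, Complex.ofReal_re, Complex.ofReal_im,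
    Complex.sub_re, Complex.sub_im, Complex.add_re, Complex.add_im] at hre him
  have key : Complex.normSq (d - W) * (d.im + W.im) = -R ^ 2 * (d.im - W.im) := by
    rw [Complex.normSq_apply]
    simp only [Complex.sub_re, Complex.sub_im]
    linear_combination (d.re - W.re) * him - (d.im - W.im) * hre
  have : ‖d - W‖ ^ 2 < R ^ 2 := by
    rw [← Complex.normSq_eq_norm_sq]
    have hs : 0 < d.im + W.im := by linarith
    nlinarith [pow_pos hR 2]
  exact lt_of_pow_lt_pow_left₀ 2 hR.le this

lemma image_add_mul_cos_Ioo (A : ℝ) {R : ℝ} (hR : 0 < R) :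
    (fun θ => A + R * Real.cos θ) '' Set.Ioo 0 π = Set.Ioo (A - R) (A + R) := by
  ext x
  constructor
  · rintro ⟨θ, hθ, rfl⟩
    have h1 : Real.cos θ < 1 := by
      have := Real.cos_lt_cos_of_nonneg_of_le_pi le_rfl hθ.2.le hθ.1
      simpa using this
    have h2 : -1 < Real.cos θ := by
      have := Real.cos_lt_cos_of_nonneg_of_le_pi hθ.1.le le_rfl hθ.2
      simpa using this
    constructor <;> dsimp only <;> nlinarith
  · rintro ⟨h1, h2⟩
    have l1 : -1 < (x - A) / R := by rw [lt_div_iff₀ hR]; linarith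
    have l2 : (x - A) / R < 1 := by rw [div_lt_one hR]; linarith
    refine ⟨Real.arccos ((x - A) / R), ⟨Real.arccos_pos.mpr l2, ?_⟩, ?_⟩
    · refine lt_of_le_of_ne (Real.arccos_le_pi _) fun h => ?_
      rw [Real.arccos_eq_pi] at h; linarith
    · dsimp only
      rw [Real.cos_arccos l1.le l2.le]; field_simp; ring

/-- Change of variables `x = A + R cos θ`. -/
lemma integral_Ioo_eq_integral_cos (A : ℝ) {R : ℝ} (hR : 0 < R) (g : ℝ → ℂ) :
    (IntegrableOn g (Set.Ioo (A - R) (A + R)) ↔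
      IntegrableOn (fun θ => ((R * Real.sin θ : ℝ) : ℂ) * g (A + R * Real.cos θ))
        (Set.Ioo 0 π)) ∧
    ∫ x in Set.Ioo (A - R) (A + R), g x =
      ∫ θ in Set.Ioo 0 π, ((R * Real.sin θ : ℝ) : ℂ) * g (A + R * Real.cos θ) := by
  have hd : ∀ θ ∈ Set.Ioo 0 π, HasDerivWithinAt (fun θ => A + R * Real.cos θ)
      (-(R * Real.sin θ)) (Set.Ioo 0 π) θ := by
    intro θ _
    have := ((Real.hasDerivAt_cos θ).const_mul R).const_add A
    exact (this.congr_deriv (by ring)).hasDerivWithinAt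
  have hinj : Set.InjOn (fun θ => A + R * Real.cos θ) (Set.Ioo 0 π) := by
    intro x hx y hy hxy
    have : Real.cos x = Real.cos y := mul_left_cancel₀ hR.ne' (add_left_cancel hxy)
    exact Real.injOn_cos ⟨hx.1.le, hx.2.le⟩ ⟨hy.1.le, hy.2.le⟩ this
  have hcongr : ∀ θ ∈ Set.Ioo 0 π, |-(R * Real.sin θ)| • g (A + R * Real.cos θ) =
      ((R * Real.sin θ : ℝ) : ℂ) * g (A + R * Real.cos θ) := by
    intro θ hθ
    have hs : 0 < Real.sin θ := Real.sin_pos_of_mem_Ioo hθ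
    rw [abs_neg, abs_of_pos (by positivity), Complex.real_smul]
  rw [← image_add_mul_cos_Ioo A hR]
  constructor
  · rw [integrableOn_image_iff_integrableOn_abs_deriv_smul measurableSet_Ioo hd hinj,
      integrableOn_congr_fun hcongr measurableSet_Ioo]
  · rw [integral_image_eq_integral_abs_deriv_smul measurableSet_Ioo hd hinj,
      setIntegral_congr_fun measurableSet_Ioo hcongr]

lemma measurable_compactDensity (a b p1 p2 : ℝ) : Measurable (compactDensity a b p1 p2) := by
  unfold compactDensity
  exact Measurable.ite measurableSet_Icc (by fun_prop) measurable_const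

/-- Stieltjes transform of the absolutely continuous part. The parameters `Wa`, `Wb` are the values
at `a`, `b` of the branch `W` of `√((z - A)² - R²)`. -/
lemma integral_density_smul {a b p1 p2 A R Wa Wb : ℝ} {z w : ℂ} (hab : a < b) (hp2 : 0 < p2)
    (hR : 0 < R) (hlmin : lmin a b p1 p2 = A - R) (hlmax : lmax a b p1 p2 = A + R)
    (haR : a ≤ A - R) (hbR : A + R ≤ b)
    (hWa : Wa ^ 2 = (a - A) ^ 2 - R ^ 2) (hWa' : 0 ≤ (a - A) * Wa)
    (hWb : Wb ^ 2 = (b - A) ^ 2 - R ^ 2) (hWb' : 0 ≤ (b - A) * Wb)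
    (hz : 0 < z.im) (hw : w ^ 2 = (z - A) ^ 2 - R ^ 2) (hw' : 0 < w.im) :
    Integrable (fun x : ℝ => (compactDensity a b p1 p2 x : ℂ) * (z - x)⁻¹) ∧
    ∫ x : ℝ, (compactDensity a b p1 p2 x : ℂ) * (z - x)⁻¹ =
      1 / (2 * p2) * ((z - A - w) / ((z - a) * (b - z))
        - (a - A - Wa) / ((b - a) * (z - a)) + (b - A - Wb) / ((b - a) * (z - b))) := by
  have hzr : ∀ x : ℝ, z - x ≠ 0 := fun x h => by
    have := congrArg Complex.im h
    simp at this; linarith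
  have hsupp : ∀ x ∉ Set.Icc (A - R) (A + R),
      (compactDensity a b p1 p2 x : ℂ) * (z - x)⁻¹ = 0 := by
    intro x hx
    simp [compactDensity, hlmin, hlmax, hx]
  obtain ⟨iz, ez⟩ := integral_sin_sq_div (d := z - A) hR hw
    (Or.inl (norm_sub_lt_of_im_pos hR hw (by simpa using hz) hw'))
  obtain ⟨ia, ea⟩ := integral_sin_sq_div (d := ((a - A : ℝ) : ℂ)) (W := Wa) hR
    (by exact_mod_cast hWa) (norm_sub_lt_or_eq_zero hR hWa hWa')
  obtain ⟨ib, eb⟩ := integral_sin_sq_div (d := ((b - A : ℝ) : ℂ)) (W := Wb) hR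
    (by exact_mod_cast hWb) (norm_sub_lt_or_eq_zero hR hWb hWb')
  obtain ⟨hint, heq⟩ := integral_Ioo_eq_integral_cos A hR
    (fun x : ℝ => (compactDensity a b p1 p2 x : ℂ) * (z - x)⁻¹)
  have hpi : (π : ℂ) ≠ 0 := by exact_mod_cast Real.pi_ne_zero
  have hp2c : (p2 : ℂ) ≠ 0 := by exact_mod_cast hp2.ne'
  have hba : (b : ℂ) - a ≠ 0 := by
    rw [sub_ne_zero]; exact_mod_cast hab.ne'
  have hza := hzr a
  have hzb := hzr b
  have hbz : (b : ℂ) - z ≠ 0 := fun h => hzb (by rw [← neg_sub, h, neg_zero])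
  have hcongr : ∀ θ ∈ Set.Ioo 0 π,
      ((R * Real.sin θ : ℝ) : ℂ) * ((compactDensity a b p1 p2 (A + R * Real.cos θ) : ℂ)
        * (z - (A + R * Real.cos θ : ℝ))⁻¹) =
      1 / (2 * π * p2 * ((z - a) * (b - z))) *
          (((R * Real.sin θ : ℝ) : ℂ) ^ 2 / (z - A - (R * Real.cos θ : ℝ)))
        - 1 / (2 * π * p2 * ((b - a) * (z - a))) *
          (((R * Real.sin θ : ℝ) : ℂ) ^ 2 / (((a - A : ℝ) : ℂ) - (R * Real.cos θ : ℝ)))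
        + 1 / (2 * π * p2 * ((b - a) * (z - b))) *
          (((R * Real.sin θ : ℝ) : ℂ) ^ 2 / (((b - A : ℝ) : ℂ) - (R * Real.cos θ : ℝ))) := by
    intro θ hθ
    have hs : 0 < Real.sin θ := Real.sin_pos_of_mem_Ioo hθ
    have hmem : A + R * Real.cos θ ∈ Set.Ioo (A - R) (A + R) := by
      rw [← image_add_mul_cos_Ioo A hR]; exact ⟨θ, hθ, rfl⟩
    have hdens : compactDensity a b p1 p2 (A + R * Real.cos θ) = R * Real.sin θ /
        (2 * π * p2 * (A + R * Real.cos θ - a) * (b - (A + R * Real.cos θ))) := by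
      rw [compactDensity, hlmin, hlmax, if_pos (Set.Ioo_subset_Icc_self hmem)]
      congr 1
      rw [show (A + R * Real.cos θ - (A - R)) * (A + R - (A + R * Real.cos θ))
        = (R * Real.sin θ) ^ 2 by rw [mul_pow, Real.sin_sq]; ring]
      exact Real.sqrt_sq (by positivity)
    have h1 := hzr (A + R * Real.cos θ)
    have h2 : ((A + R * Real.cos θ : ℝ) : ℂ) - a ≠ 0 := by
      rw [sub_ne_zero]; exact_mod_cast (haR.trans_lt hmem.1).ne'
    have h3 : (b : ℂ) - (A + R * Real.cos θ : ℝ) ≠ 0 := by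
      rw [sub_ne_zero]; exact_mod_cast (hmem.2.trans_le hbR).ne'
    rw [hdens]
    have e1 : z - A - (R * Real.cos θ : ℝ) = z - (A + R * Real.cos θ : ℝ) := by push_cast; ring
    have e2 : ((a - A : ℝ) : ℂ) - (R * Real.cos θ : ℝ)
        = -(((A + R * Real.cos θ : ℝ) : ℂ) - a) := by push_cast; ring
    have e3 : ((b - A : ℝ) : ℂ) - (R * Real.cos θ : ℝ) = b - (A + R * Real.cos θ : ℝ) := by
      push_cast; ring
    have e4 : z - b = -(b - z) := by ring
    rw [e1, e2, e3, e4]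
    generalize A + R * Real.cos θ = x at *
    generalize R * Real.sin θ = s at *
    push_cast
    field_simp
    ring
  have iz' := iz.const_mul (1 / (2 * π * p2 * ((z - a) * (b - z))) : ℂ)
  have ia' := ia.const_mul (1 / (2 * π * p2 * ((b - a) * (z - a))) : ℂ)
  have ib' := ib.const_mul (1 / (2 * π * p2 * ((b - a) * (z - b))) : ℂ)
  constructor
  · rw [← integrableOn_iff_integrable_of_support_subset (s := Set.Icc (A - R) (A + R)),
      integrableOn_Icc_iff_integrableOn_Ioo, hint, integrableOn_congr_fun hcongr measurableSet_Ioo]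
    · exact (iz'.sub ia').add ib'
    · intro x hx
      by_contra h
      exact hx (hsupp x h)
  · rw [← setIntegral_eq_integral_of_forall_compl_eq_zero (s := Set.Icc (A - R) (A + R)) hsupp,
      integral_Icc_eq_integral_Ioo, heq, setIntegral_congr_fun measurableSet_Ioo hcongr,
      integral_add _ ib', integral_sub iz' ia', integral_const_mul,
      integral_const_mul, integral_const_mul, ez, ea, eb]
    · push_cast
      field_simp
    · exact iz'.sub ia'

/-- The Stieltjes transform of the measure `μ_{a,b,p1,p2}` on the upper half
plane, where `α = a+(b-a)(p1 q2 + p2 q1)`, `β = (b-a)² p1 q1 p2 q2`. -/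
theorem statement15 (a b p1 p2 : ℝ) (hab : a < b)
    (hp1 : p1 ∈ Set.Ioo (0 : ℝ) 1) (hp2 : p2 ∈ Set.Ioo (0 : ℝ) 1)
    (al be : ℝ)
    (hal : al = a + (b - a) * (p1 * (1 - p2) + p2 * (1 - p1)))
    (hbe : be = (b - a) ^ 2 * p1 * (1 - p1) * p2 * (1 - p2))
    (z : ℂ) (hz : 0 < z.im)
    (Φ : ℂ) (hΦ : Φ = ∫ x, (z - (x : ℂ))⁻¹ ∂(muCompact a b p1 p2)) :
    ∀ w : ℂ, w ^ 2 = (z - (al : ℂ)) ^ 2 - 4 * (be : ℂ) → 0 < w.im →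
      Φ = (((1 - 2 * p2 : ℝ) : ℂ) * z + (al : ℂ)
            - 2 * ((1 - p2 : ℝ) : ℂ) * ((a + (b - a) * p1 : ℝ) : ℂ) - w) /
          (2 * (p2 : ℂ) * (z - (a : ℂ)) * ((b : ℂ) - z)) := by
  intro w hw hwim
  obtain ⟨hp1, hp1'⟩ := hp1
  obtain ⟨hp2, hp2'⟩ := hp2
  have hq1 : 0 < 1 - p1 := by linarith
  have hq2 : 0 < 1 - p2 := by linarith
  have hba : 0 < b - a := by linarith
  obtain ⟨s, hs⟩ : ∃ s, s = Real.sqrt (p1 * (1 - p2)) := ⟨_, rfl⟩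
  obtain ⟨t, ht⟩ : ∃ t, t = Real.sqrt (p2 * (1 - p1)) := ⟨_, rfl⟩
  have hs0 : 0 < s := by rw [hs]; exact Real.sqrt_pos.mpr (by positivity)
  have ht0 : 0 < t := by rw [ht]; exact Real.sqrt_pos.mpr (by positivity)
  have hs2 : s ^ 2 = p1 * (1 - p2) := by rw [hs]; exact Real.sq_sqrt (by positivity)
  have ht2 : t ^ 2 = p2 * (1 - p1) := by rw [ht]; exact Real.sq_sqrt (by positivity)
  obtain ⟨R, hRdef⟩ : ∃ R, R = 2 * (b - a) * (s * t) := ⟨_, rfl⟩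
  have hR : 0 < R := by rw [hRdef]; positivity
  have hR2 : R ^ 2 = 4 * be := by
    rw [hRdef, hbe, show (2 * (b - a) * (s * t)) ^ 2 = 4 * (b - a) ^ 2 * (s ^ 2 * t ^ 2) by ring,
      hs2, ht2]
    ring
  have hst : s * t ≤ (p1 * p2 + (1 - p1) * (1 - p2)) / 2 := by
    apply le_of_sq_le_sq _ (by positivity)
    rw [mul_pow, hs2, ht2]
    nlinarith [sq_nonneg (p1 * p2 - (1 - p1) * (1 - p2))]
  have hlmin : lmin a b p1 p2 = al - R := by
    rw [lmin, ← hs, ← ht, hal, hRdef]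
    linear_combination (b - a) * (hs2 + ht2)
  have hlmax : lmax a b p1 p2 = al + R := by
    rw [lmax, ← hs, ← ht, hal, hRdef]
    linear_combination (b - a) * (hs2 + ht2)
  have haR : a ≤ al - R := by
    rw [← hlmin, lmin]
    have := mul_nonneg hba.le (sq_nonneg (√(p1 * (1 - p2)) - √(p2 * (1 - p1))))
    linarith
  have hbR : al + R ≤ b := by
    rw [hal, hRdef]
    nlinarith
  have hcR : ((R : ℂ)) ^ 2 = 4 * be := by exact_mod_cast hR2
  have haA : a - al ≤ 0 := by linarith
  have hbA : 0 ≤ b - al := by linarith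
  obtain ⟨hi, he⟩ := integral_density_smul (Wa := -((b - a) * |p1 - p2|))
    (Wb := (b - a) * |1 - p1 - p2|) hab hp2 hR hlmin hlmax haR hbR
    (by rw [neg_sq, mul_pow, sq_abs, hR2, hal, hbe]; ring)
    (mul_nonneg_of_nonpos_of_nonpos haA (neg_nonpos.mpr (by positivity)))
    (by rw [mul_pow, sq_abs, hR2, hal, hbe]; ring)
    (mul_nonneg hbA (by positivity)) hz (by rw [hcR]; exact hw) hwim
  have hnonneg : ∀ x, 0 ≤ compactDensity a b p1 p2 x := by
    intro x
    rw [compactDensity]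
    split_ifs with hx
    · rw [hlmin, hlmax] at hx
      have h1 : 0 ≤ x - a := by linarith [hx.1]
      have h2 : 0 ≤ b - x := by linarith [hx.2]
      positivity
    · exact le_rfl
  have hmeas : Measurable fun x => ENNReal.ofReal (compactDensity a b p1 p2 x) :=
    (measurable_compactDensity a b p1 p2).ennreal_ofReal
  have hfin : ∀ᵐ x : ℝ, ENNReal.ofReal (compactDensity a b p1 p2 x) < ⊤ :=
    Eventually.of_forall fun _ => ENNReal.ofReal_lt_top
  have hsmul : (fun x : ℝ => (ENNReal.ofReal (compactDensity a b p1 p2 x)).toReal •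
      (z - (x : ℂ))⁻¹) = fun x : ℝ => (compactDensity a b p1 p2 x : ℂ) * (z - x)⁻¹ := by
    funext x
    rw [ENNReal.toReal_ofReal (hnonneg x), Complex.real_smul]
  have hI : Integrable (fun x : ℝ => (z - (x : ℂ))⁻¹)
      (volume.withDensity fun x => ENNReal.ofReal (compactDensity a b p1 p2 x)) := by
    rw [integrable_withDensity_iff_integrable_smul' hmeas hfin, hsmul]
    exact hi
  have hδ : ∀ c y : ℝ, Integrable (fun x : ℝ => (z - (x : ℂ))⁻¹)
      (ENNReal.ofReal c • Measure.dirac y) := fun c y =>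
    (integrable_dirac enorm_lt_top).smul_measure ENNReal.ofReal_ne_top
  rw [hΦ, muCompact, integral_add_measure (hI.add_measure (hδ _ _)) (hδ _ _),
    integral_add_measure hI (hδ _ _), integral_smul_measure, integral_smul_measure,
    integral_dirac, integral_dirac, integral_withDensity_eq_integral_toReal_smul hmeas hfin,
    hsmul, he, ENNReal.toReal_ofReal (le_max_right _ _), ENNReal.toReal_ofReal (le_max_right _ _),
    Complex.real_smul, Complex.real_smul]
  have hzr : ∀ x : ℝ, z - x ≠ 0 := fun x h => by
    have := congrArg Complex.im h
    simp at this; linarith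
  have hmaxa : max (1 - p1 / p2) 0 = (p2 - p1 + |p1 - p2|) / (2 * p2) := by
    rcases le_total p1 p2 with h | h
    · rw [max_eq_left (by rw [sub_nonneg, div_le_one hp2]; exact h),
        abs_of_nonpos (by linarith)]
      field_simp; ring
    · rw [max_eq_right (by rw [sub_nonpos, one_le_div hp2]; exact h),
        abs_of_nonneg (by linarith)]
      ring
  have hmaxb : max ((p1 + p2 - 1) / p2) 0 = (p1 + p2 - 1 + |1 - p1 - p2|) / (2 * p2) := by
    rcases le_total 1 (p1 + p2) with h | h
    · rw [max_eq_left (div_nonneg (by linarith) hp2.le), abs_of_nonpos (by linarith)]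
      field_simp; ring
    · rw [max_eq_right (div_nonpos_of_nonpos_of_nonneg (by linarith) hp2.le),
        abs_of_nonneg (by linarith)]
      ring
  have hp2c : (p2 : ℂ) ≠ 0 := by exact_mod_cast hp2.ne'
  have hbac : (b : ℂ) - a ≠ 0 := by exact_mod_cast hba.ne'
  have hza := hzr a
  have hzb := hzr b
  have hbz : (b : ℂ) - z ≠ 0 := fun h => hzb (by rw [← neg_sub, h, neg_zero])
  have hzb' : z - b = -(b - z) := by ring
  rw [hmaxa, hmaxb, hal, hzb']
  generalize |p1 - p2| = u
  generalize |1 - p1 - p2| = v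
  push_cast
  field_simp
  ring

end
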